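/- arXiv:1802.04616 — 2 statements merged into one kernel-verified Lean document; each statement's English description precedes it below -/
import Mathlib

section
/- The following identity holds: ∑_{n=0}^∞ C(4n,2n)^2 C(2n,n) / 2^{12n} · (48n^2 + 32n + 3) / (2n+1) = 8√2/π. -/
open Filter Topology in
/-- If `a` has a limit along `ℕ` and `S` lies between `a n` and `(n + 1) / n * a n`,
then `S` has the same limit. -/
lemma tendsto_of_le_of_le_succ_div_mul {a S : ℕ → ℝ} {l : ℝ} (ha : Tendsto a atTop (𝓝 l))
    (h₁ : ∀ n, a n ≤ S n) (h₂ : ∀ n : ℕ, (n : ℝ) * S n ≤ (n + 1) * a n) :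
    Tendsto S atTop (𝓝 l) := by
  have hb : Tendsto (fun n : ℕ => (1 + 1 / (n : ℝ)) * a n) atTop (𝓝 l) := by
    simpa using ((tendsto_const_nhds (x := (1 : ℝ))).add tendsto_one_div_atTop_nhds_zero_nat).mul ha
  refine tendsto_of_tendsto_of_tendsto_of_le_of_le' ha hb (Eventually.of_forall h₁) ?_
  filter_upwards [eventually_gt_atTop 0] with n hn
  have hn' : (0 : ℝ) < n := by exact_mod_cast hn
  have : (1 + 1 / (n : ℝ)) * a n = (n + 1) * a n / n := by field_simp
  rw [this, le_div_iff₀ hn']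
  linarith [h₂ n]

namespace GaussWZ

open Filter Topology Finset
open scoped Nat

/-- The ratio `(1/4)_n (3/4)_n / n!` of Pochhammer symbols, in factorial form. -/
noncomputable def weight (n : ℕ) : ℝ := (4 * n)! / ((2 * n)! * n ! * 64 ^ n)

lemma weight_pos (n : ℕ) : 0 < weight n := by
  unfold weight; positivity

@[simp] lemma weight_zero : weight 0 = 1 := by simp [weight]

lemma weight_succ (n : ℕ) :
    weight (n + 1) = weight n * ((4 * n + 1) * (4 * n + 3)) / (16 * (n + 1)) := by
  have h4 : 4 * (n + 1) = 4 * n + 1 + 1 + 1 + 1 := by ring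
  have h2 : 2 * (n + 1) = 2 * n + 1 + 1 := by ring
  simp only [weight, h4, h2, Nat.factorial_succ, pow_succ]
  push_cast
  field_simp
  ring

lemma weight_succ_le (n : ℕ) : weight (n + 1) ≤ (n + 1) * weight n := by
  rw [weight_succ, div_le_iff₀ (by positivity)]
  have := weight_pos n
  have hn : (0 : ℝ) ≤ n := n.cast_nonneg
  nlinarith [mul_nonneg this.le hn]

/-- The Wilf–Zeilberger mate of Gauss's sum `₂F₁(1/4, 3/4; N + 2; 1)`. -/
noncomputable def kernel (N k : ℕ) : ℝ :=
  weight N * ((4 * N + 1) * (4 * N + 3)) * (weight k / (N + k + 1)!)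

lemma kernel_eq (N k : ℕ) :
    kernel N k = 16 * (N + 1) * weight (N + 1) * (weight k / (N + k + 1)!) := by
  rw [kernel, weight_succ]
  field_simp

lemma sum_kernel_succ (N m : ℕ) :
    ∑ k ∈ range m, kernel (N + 1) k
      = ∑ k ∈ range m, kernel N k + kernel N m * m / (N + 1) := by
  induction m with
  | zero => simp
  | succ m ih =>
    have h : N + 1 + m + 1 = N + m + 1 + 1 := by ring
    have h' : N + (m + 1) + 1 = N + m + 1 + 1 := by ring
    rw [sum_range_succ, sum_range_succ, ih]
    simp only [kernel, weight_succ, h, h', Nat.factorial_succ (N + m + 1)]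
    push_cast
    field_simp
    ring

/-- The `n`-th term of the series. -/
noncomputable def term (n : ℕ) : ℝ :=
  weight n ^ 2 / (2 * n + 1)! * (48 * n ^ 2 + 32 * n + 3)

lemma term_eq_choose (n : ℕ) :
    ((Nat.choose (4 * n) (2 * n) : ℝ)) ^ 2 * (Nat.choose (2 * n) n) /
        2 ^ (12 * n) * ((48 * n ^ 2 + 32 * n + 3) / (2 * n + 1)) = term n := by
  have h4 : 4 * n - 2 * n = 2 * n := by omega
  have h2 : 2 * n - n = n := by omega
  have hp : (2 : ℝ) ^ (12 * n) = (64 ^ n) ^ 2 := by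
    rw [← pow_mul, mul_comm n 2, pow_mul, pow_mul]; norm_num
  rw [Nat.cast_choose ℝ (by omega : 2 * n ≤ 4 * n), Nat.cast_choose ℝ (by omega : n ≤ 2 * n),
    h4, h2, hp, term, weight, Nat.factorial_succ (2 * n)]
  push_cast
  field_simp

lemma term_succ (N : ℕ) :
    term (N + 1) = kernel (N + 1) (N + 1) + kernel N (N + 1) := by
  have h : 2 * (N + 1) + 1 = N + (N + 1) + 1 + 1 := by ring
  have h' : N + 1 + (N + 1) + 1 = N + (N + 1) + 1 + 1 := by ring
  rw [kernel_eq N, kernel, term, h, h', Nat.factorial_succ (N + (N + 1) + 1)]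
  push_cast
  field_simp
  ring

lemma sum_term (N : ℕ) :
    ∑ n ∈ range (N + 1), term n = ∑ k ∈ range (N + 1), kernel N k := by
  induction N with
  | zero => simp [term, kernel]
  | succ N ih =>
    rw [sum_range_succ, ih, term_succ, sum_range_succ _ (N + 1), sum_kernel_succ]
    push_cast
    field_simp
    ring

lemma mul_sum_weight_div_factorial_le (N m : ℕ) :
    (N : ℝ) * ∑ k ∈ range m, weight k / (N + k + 1)! + weight m / (N + m)! ≤ 1 / N ! := by
  induction m with
  | zero => simp
  | succ m ih =>
    refine le_trans ?_ ih
    have h : N + (m + 1) = N + m + 1 := by ring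
    rw [sum_range_succ, h, Nat.factorial_succ, mul_add, add_assoc]
    gcongr
    have hle := weight_succ_le m
    push_cast
    rw [← mul_div_assoc, ← add_div, div_le_div_iff₀ (by positivity) (by positivity)]
    have hf : (0 : ℝ) < (N + m)! := by positivity
    nlinarith [mul_le_mul_of_nonneg_right hle hf.le]

lemma prod_eq_weight (n : ℕ) :
    (∏ j ∈ range n, ((1 / 4 : ℝ) + j)) * ∏ j ∈ range n, ((3 / 4 : ℝ) + j) = weight n * n ! := by
  induction n with
  | zero => simp
  | succ n ih =>
    rw [prod_range_succ, prod_range_succ, mul_mul_mul_comm, ih, weight_succ, Nat.factorial_succ]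
    push_cast
    field_simp
    ring

lemma gamma_quarter_mul_gamma_three_quarters :
    Real.Gamma (1 / 4) * Real.Gamma (3 / 4) = Real.pi * √2 := by
  have h := Real.Gamma_mul_Gamma_one_sub (1 / 4)
  rw [show (1 : ℝ) - 1 / 4 = 3 / 4 by norm_num,
    show Real.pi * (1 / 4) = Real.pi / 4 by ring, Real.sin_pi_div_four] at h
  rw [h]
  have h2 : √2 * √2 = (2 : ℝ) := Real.mul_self_sqrt (by norm_num)
  field_simp
  linarith

lemma tendsto_weight_succ_div_factorial :
    Tendsto (fun n : ℕ => 16 * (weight (n + 1) / n !)) atTop (𝓝 (8 * √2 / Real.pi)) := by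
  have h := (Real.GammaSeq_tendsto_Gamma (1 / 4)).mul (Real.GammaSeq_tendsto_Gamma (3 / 4))
  rw [gamma_quarter_mul_gamma_three_quarters] at h
  have hne : Real.pi * √2 ≠ 0 := by positivity
  have h' := ((h.inv₀ hne).mul (tendsto_natCast_div_add_atTop (1 : ℝ))).const_mul 16
  have hl : 16 * ((Real.pi * √2)⁻¹ * 1) = 8 * √2 / Real.pi := by
    have h2 : √2 * √2 = (2 : ℝ) := Real.mul_self_sqrt (by norm_num)
    field_simp
    linarith
  rw [hl] at h'
  refine h'.congr' ?_
  filter_upwards [eventually_gt_atTop 0] with n hn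
  have hn' : (0 : ℝ) < n := by exact_mod_cast hn
  have hpow : (n : ℝ) ^ (1 / 4 : ℝ) * (n : ℝ) ^ (3 / 4 : ℝ) = n := by
    rw [← Real.rpow_add hn']; norm_num
  have hG : Real.GammaSeq (1 / 4) n * Real.GammaSeq (3 / 4) n
      = n * (n ! * n !) / (weight (n + 1) * (n + 1)!) := by
    rw [Real.GammaSeq, Real.GammaSeq, div_mul_div_comm, prod_eq_weight, mul_mul_mul_comm, hpow]
  have hw := (weight_pos (n + 1)).ne'
  rw [hG, Nat.factorial_succ]
  push_cast
  field_simp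

lemma hasSum_term : HasSum term (8 * √2 / Real.pi) := by
  have hnonneg (n : ℕ) : 0 ≤ term n := by unfold term; positivity
  rw [hasSum_iff_tendsto_nat_of_nonneg hnonneg, ← tendsto_add_atTop_iff_nat 1]
  have hS (N : ℕ) : ∑ n ∈ range (N + 1), term n
      = 16 * (N + 1) * weight (N + 1) * ∑ k ∈ range (N + 1), weight k / (N + k + 1)! := by
    simp only [sum_term, kernel_eq, mul_sum]
  refine tendsto_of_le_of_le_succ_div_mul tendsto_weight_succ_div_factorial
    (fun N => ?_) (fun N => ?_)
  · have hle : 1 / ((N + 1)! : ℝ) ≤ ∑ k ∈ range (N + 1), weight k / (N + k + 1)! := by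
      have := single_le_sum (f := fun k => weight k / ((N + k + 1)! : ℝ))
        (fun k _ => div_nonneg (weight_pos k).le (by positivity))
        (mem_range.2 N.succ_pos)
      simpa using this
    have hw := weight_pos (N + 1)
    calc 16 * (weight (N + 1) / N !)
        = 16 * (N + 1) * weight (N + 1) * (1 / ((N + 1)! : ℝ)) := by
          rw [Nat.factorial_succ]; push_cast; field_simp
      _ ≤ _ := by rw [hS]; gcongr
  · have hw := weight_pos (N + 1)
    have hle : (N : ℝ) * ∑ k ∈ range (N + 1), weight k / (N + k + 1)! ≤ 1 / N ! := by
      have := mul_sum_weight_div_factorial_le N (N + 1)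
      have : 0 ≤ weight (N + 1) / ((N + (N + 1))! : ℝ) := by positivity
      linarith
    calc (N : ℝ) * ∑ n ∈ range (N + 1), term n
        = 16 * (N + 1) * weight (N + 1)
            * (N * ∑ k ∈ range (N + 1), weight k / (N + k + 1)!) := by rw [hS]; ring
      _ ≤ 16 * (N + 1) * weight (N + 1) * (1 / N !) := by gcongr
      _ = _ := by ring

end GaussWZ

/-- The `q → 1` limiting case of the third identity of Theorem 1:
`∑ C(4n,2n)² C(2n,n) (48n²+32n+3)/(2^{12n}(2n+1)) = 8√2/π`. -/
theorem ramanujan_type_8_sqrt2_div_pi :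
    ∑' n : ℕ, ((Nat.choose (4 * n) (2 * n) : ℝ)) ^ 2 * (Nat.choose (2 * n) n) /
        2 ^ (12 * n) * ((48 * n ^ 2 + 32 * n + 3) / (2 * n + 1)) =
      8 * Real.sqrt 2 / Real.pi := by
  simp only [GaussWZ.term_eq_choose]
  exact GaussWZ.hasSum_term.tsum_eq
end

section
/- Let F, G : ℕ × ℕ → ℂ satisfy F(n,k+1) - F(n,k) = G(n+1,k) - G(n,k) for all nonnegative integers n, k. Define F₂(n,k) = F(n, n+k) + G(n+1, n+k) and G₂(n,k) = G(n, n+k). Then F₂(n,k+1) - F₂(n,k) = G₂(n+1,k) - G₂(n,k) for all nonnegative integers n, k. -/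
/-- Guillera's iteration of a WZ pair along the diagonal. -/
theorem wz_pair_iteration (F G : ℕ × ℕ → ℂ)
    (hFG : ∀ n k : ℕ, F (n, k + 1) - F (n, k) = G (n + 1, k) - G (n, k))
    (F₂ G₂ : ℕ × ℕ → ℂ)
    (hF₂ : ∀ n k : ℕ, F₂ (n, k) = F (n, n + k) + G (n + 1, n + k))
    (hG₂ : ∀ n k : ℕ, G₂ (n, k) = G (n, n + k)) :
    ∀ n k : ℕ, F₂ (n, k + 1) - F₂ (n, k) = G₂ (n + 1, k) - G₂ (n, k) := by
  intro n k
  rw [hF₂, hF₂, hG₂, hG₂, ← Nat.add_assoc n k 1, Nat.add_right_comm n 1 k]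
  linear_combination hFG n (n + k)
end
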